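/- Let I = (f_1,…,f_n) be a generic ideal of type (n+1; d_1,…,d_n) in R' = K[x_1,…,x_n,z] (with variables ordered x_1 > ⋯ > x_n > z) and let J = π(I) ⊆ K[x_1,…,x_n] be the image of I under the K-algebra homomorphism π sending z to 0 and fixing x_1,…,x_n. Then the initial ideals in(I) and in(J) with respect to the degree reverse lexicographic order have the same set of minimal monomial generators. -/

import Mathlib

open MvPolynomial

/-- The total degree of an exponent vector. -/
def expDeg {n : ℕ} (μ : Fin n →₀ ℕ) : ℕ := μ.sum fun _ e => e

/-- Strict degree reverse lexicographic order on exponent vectors, for variables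
`x_1 > ⋯ > x_n` (indexed by `Fin n` in this order). -/
def DrlLT {n : ℕ} (a b : Fin n →₀ ℕ) : Prop :=
  expDeg a < expDeg b ∨
    (expDeg a = expDeg b ∧ ∃ i : Fin n, b i < a i ∧ ∀ j : Fin n, i < j → a j = b j)

/-- `μ` is the leading (degrevlex-largest) exponent of `p`. -/
def IsLeadExp {n : ℕ} {K : Type*} [CommSemiring K] (p : MvPolynomial (Fin n) K)
    (μ : Fin n →₀ ℕ) : Prop :=
  μ ∈ p.support ∧ ∀ ν ∈ p.support, ν ≠ μ → DrlLT ν μ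

/-- The initial ideal of `I` with respect to the degree reverse lexicographic order. -/
noncomputable def initialIdeal {n : ℕ} {K : Type*} [CommRing K]
    (I : Ideal (MvPolynomial (Fin n) K)) : Ideal (MvPolynomial (Fin n) K) :=
  Ideal.span { m | ∃ p ∈ I, p ≠ 0 ∧ ∃ μ, IsLeadExp p μ ∧ m = monomial μ (1 : K) }

/-- The standard monomials of degree `i` of `I` : exponents of the monomials of degree `i`
not lying in the initial ideal of `I`. -/
def stdMon {n : ℕ} {K : Type*} [CommRing K] (I : Ideal (MvPolynomial (Fin n) K)) (i : ℕ) :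
    Set (Fin n →₀ ℕ) :=
  { μ | expDeg μ = i ∧ monomial μ (1 : K) ∉ initialIdeal I }

/-- `μ` is a minimal monomial generator of the monomial ideal `M`. -/
def IsMinGen {n : ℕ} {K : Type*} [CommRing K] (M : Ideal (MvPolynomial (Fin n) K))
    (μ : Fin n →₀ ℕ) : Prop :=
  monomial μ (1 : K) ∈ M ∧ ∀ ν : Fin n →₀ ℕ, ν ≤ μ → ν ≠ μ → monomial ν (1 : K) ∉ M

/-- `μ` satisfies property `P` with respect to the monomial ideal `M`: if `m` is the largest
index of a variable dividing `x^μ`, then every monomial of the same degree in the variables of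
index `< m` also lies in `M`. -/
def SatisfiesP {n : ℕ} {K : Type*} [CommRing K] (M : Ideal (MvPolynomial (Fin n) K))
    (μ : Fin n →₀ ℕ) : Prop :=
  ∀ m : Fin n, μ m ≠ 0 → (∀ j : Fin n, m < j → μ j = 0) →
    ∀ ν : Fin n →₀ ℕ, expDeg ν = expDeg μ → (∀ j : Fin n, m ≤ j → ν j = 0) →
      monomial ν (1 : K) ∈ M

/-- Conjecture E (Pardue) holds for the ideal `I`: every minimal generator of the initial
ideal of `I` satisfies property `P`. -/
def ConjE {n : ℕ} {K : Type*} [CommRing K] (I : Ideal (MvPolynomial (Fin n) K)) : Prop :=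
  ∀ μ, IsMinGen (initialIdeal I) μ → SatisfiesP (initialIdeal I) μ

/-- `f` is a generic sequence of forms of degrees `d i` over the base field `F`: each `f i` is
homogeneous of degree `d i` and the family of all coefficients (at all monomials of degree
`d i`) is algebraically independent over `F`. -/
def IsGenericSeq (F : Type*) {K : Type*} [CommRing F] [CommRing K] [Algebra F K]
    {n r : ℕ} (d : Fin r → ℕ) (f : Fin r → MvPolynomial (Fin n) K) : Prop :=
  (∀ i, (f i).IsHomogeneous (d i)) ∧
    AlgebraicIndependent F
      (fun p : Σ i : Fin r, { μ : Fin n →₀ ℕ // expDeg μ = d i } => (f p.1).coeff p.2.1)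

/-- The projection `K[x_1,…,x_n,z] → K[x_1,…,x_n]` sending `z` (the last variable) to `0` and
fixing the other variables. -/
noncomputable def projMap (K : Type*) [CommRing K] (n : ℕ) :
    MvPolynomial (Fin (n + 1)) K →ₐ[K] MvPolynomial (Fin n) K :=
  aeval (fun i => Fin.lastCases 0 (fun j => X j) i)

/-- Embedding of exponent vectors of `K[x_1,…,x_n]` into those of `K[x_1,…,x_n,z]`
(`z`-exponent `0`). -/
noncomputable def embExp {n : ℕ} (μ : Fin n →₀ ℕ) : Fin (n + 1) →₀ ℕ :=
  Finsupp.embDomain ⟨Fin.castSucc, Fin.castSucc_injective n⟩ μ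

/-- Multiplication by `z^c` on exponent vectors in `K[x_1,…,x_n,z]`. -/
noncomputable def zShift {n : ℕ} (c : ℕ) (μ : Fin (n + 1) →₀ ℕ) : Fin (n + 1) →₀ ℕ :=
  μ + Finsupp.single (Fin.last n) c

/-- `f` (homogeneous of degree `e`) is semi-regular on `R/I`: in each degree `t`, the
multiplication map `(R/I)_t → (R/I)_{t+e}` is injective or surjective. -/
def SemiRegularOn {vars K : Type*} [CommRing K] (I : Ideal (MvPolynomial vars K))
    (f : MvPolynomial vars K) (e : ℕ) : Prop :=
  ∀ t : ℕ,
    (∀ p ∈ homogeneousSubmodule vars K t, f * p ∈ I → p ∈ I) ∨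
    (∀ q ∈ homogeneousSubmodule vars K (t + e),
      ∃ p ∈ homogeneousSubmodule vars K t, q - f * p ∈ I)

/-- The degree-`t` graded piece of `R/I`, as a `K`-submodule of the quotient. -/
noncomputable def quotDegPart {vars K : Type*} [CommRing K] (I : Ideal (MvPolynomial vars K))
    (t : ℕ) : Submodule K (MvPolynomial vars K ⧸ I) :=
  (homogeneousSubmodule vars K t).map (Ideal.Quotient.mkₐ K I).toLinearMap

section KoszulHomotopy

variable {ι S T : Type*} [CommRing S] [CommRing T]

lemma exists_le_add_single (e : ι → ℕ) (ν : ι →₀ ℕ) (j : ι) :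
    ∃ i, e i ≤ (ν + Finsupp.single j (e j)) i :=
  ⟨j, by simp⟩

lemma monomial_eq_smul_one (ν : ι →₀ ℕ) (a : S) : monomial ν a = a • monomial ν (1 : S) := by
  rw [smul_monomial, smul_eq_mul, mul_one]

variable [DecidableEq ι]

open Classical in
/-- Division of `x^ν` by one of the pure powers `x_i^{e i}` dividing it, placed in the `i`-th
coordinate, extended linearly. -/
noncomputable def powerContraction (S : Type*) [CommRing S] (e : ι → ℕ) :
    MvPolynomial ι S →ₗ[S] (ι → MvPolynomial ι S) :=
  (basisMonomials ι S).constr S fun ν =>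
    if h : ∃ i, e i ≤ ν i then
      Pi.single h.choose (monomial (ν - Finsupp.single h.choose (e h.choose)) 1)
    else 0

/-- A multiple of the Koszul relation between `G j` and `G s`, where `x_s^{e s}` is the chosen
pure power dividing `x^ν x_j^{e j}`. -/
noncomputable def koszulRelation (e : ι → ℕ) (G : ι → MvPolynomial ι S) (j : ι) (ν : ι →₀ ℕ) :
    ι → MvPolynomial ι S :=
  let s := (exists_le_add_single e ν j).choose
  fun i => monomial (ν - Finsupp.single s (e s)) 1 *
    ((Pi.single j (G s) : ι → MvPolynomial ι S) i - (Pi.single s (G j) : ι → MvPolynomial ι S) i)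

/-- The sum of a Koszul boundary and a contraction of `∑ i, v i * G i`; for `G i = x_i^{e i}`
it fixes every basis tuple. -/
noncomputable def koszulEndo (e : ι → ℕ) (G : ι → MvPolynomial ι S) (j : ι) (ν : ι →₀ ℕ) :
    ι → MvPolynomial ι S :=
  koszulRelation e G j ν + powerContraction S e (monomial ν 1 * G j)

/-- Tuples `v` such that `v j` is homogeneous of degree `t - e j`. -/
def tupleDeg (S : Type*) [CommRing S] (e : ι → ℕ) (t : ℕ) :
    Submodule S (ι → MvPolynomial ι S) where
  carrier := {v | ∀ j ν, coeff ν (v j) ≠ 0 → ν.degree + e j = t}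
  add_mem' {v w} hv hw j ν h := by
    by_cases h1 : coeff ν (v j) = 0
    · exact hw j ν fun h2 => h (by simp [h1, h2])
    · exact hv j ν h1
  zero_mem' j ν h := by simp at h
  smul_mem' c v hv j ν h := hv j ν fun h1 => h (by simp [h1])

lemma single_mem_tupleDeg (e : ι → ℕ) (t : ℕ) (j : ι) (p : MvPolynomial ι S)
    (h : ∀ ν, coeff ν p ≠ 0 → ν.degree + e j = t) : Pi.single j p ∈ tupleDeg S e t := by
  intro i ν hν
  by_cases hij : i = j
  · subst hij; exact h ν (by simpa using hν)
  · simp [hij] at hν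

lemma koszulRelation_mem_span (e : ι → ℕ) (G : ι → MvPolynomial ι S) (j : ι) (ν : ι →₀ ℕ)
    (l : ι) : koszulRelation e G j ν l ∈ Ideal.span (G '' {l}ᶜ) := by
  have hG : ∀ i, i ≠ l → G i ∈ Ideal.span (G '' {l}ᶜ) := fun i hi =>
    Ideal.subset_span ⟨i, hi, rfl⟩
  apply Ideal.mul_mem_left
  generalize (exists_le_add_single e ν j).choose = s
  by_cases hj : j = l <;> by_cases hs : s = l
  · subst hj; subst hs; simp
  · subst hj; simpa [Pi.single_apply, Ne.symm hs] using hG s hs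
  · subst hs; simpa [Pi.single_apply, Ne.symm hj] using hG j hj
  · simp [Ne.symm hj, Ne.symm hs]

lemma powerContraction_monomial (e : ι → ℕ) (ν : ι →₀ ℕ) (h : ∃ i, e i ≤ ν i) :
    powerContraction S e (monomial ν 1) =
      Pi.single h.choose (monomial (ν - Finsupp.single h.choose (e h.choose)) 1) := by
  exact (congrArg _ (congrFun (coe_basisMonomials ι S) ν).symm).trans
    (((basisMonomials ι S).constr_basis S _ ν).trans (dif_pos h))

lemma powerContraction_monomial_of_not (e : ι → ℕ) (ν : ι →₀ ℕ) (h : ¬ ∃ i, e i ≤ ν i) :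
    powerContraction S e (monomial ν 1) = 0 := by
  exact (congrArg _ (congrFun (coe_basisMonomials ι S) ν).symm).trans
    (((basisMonomials ι S).constr_basis S _ ν).trans (dif_neg h))

lemma koszulEndo_powers (e : ι → ℕ) (j : ι) (ν : ι →₀ ℕ) :
    koszulEndo e (fun i => monomial (Finsupp.single i (e i)) (1 : S)) j ν =
      Pi.single j (monomial ν 1) := by
  have h := exists_le_add_single e ν j
  rw [koszulEndo, monomial_mul, one_mul, powerContraction_monomial e _ h]
  unfold koszulRelation
  have hs := h.choose_spec
  generalize h.choose = s at hs
  ext1 i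
  simp only [Pi.add_apply]
  by_cases hsj : s = j
  · subst hsj; simp
  · have hle : Finsupp.single s (e s) ≤ ν := by
      rw [Finsupp.single_le_iff]
      simpa [Finsupp.single_apply, Ne.symm hsj] using hs
    rw [mul_sub]
    simp only [Pi.single_apply, mul_ite, monomial_mul, mul_zero, one_mul]
    rw [tsub_add_cancel_of_le hle, tsub_add_eq_add_tsub hle]
    abel

lemma map_powerContraction (φ : S →+* T) (e : ι → ℕ) (p : MvPolynomial ι S) (i : ι) :
    map φ (powerContraction S e p i) = powerContraction T e (map φ p) i := by
  induction p using MvPolynomial.induction_on' with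
  | monomial ν a =>
    rw [map_monomial, monomial_eq_smul_one ν a, monomial_eq_smul_one ν (φ a), map_smul, map_smul, Pi.smul_apply, Pi.smul_apply,
      smul_eq_C_mul, smul_eq_C_mul, map_mul, map_C]
    congr 1
    by_cases h : ∃ i, e i ≤ ν i
    · rw [powerContraction_monomial e ν h, powerContraction_monomial e ν h]
      simp only [Pi.single_apply, apply_ite (map φ), map_zero, map_monomial, map_one]
    · simp [powerContraction_monomial_of_not e ν h]
  | add p q hp hq => simp only [map_add, Pi.add_apply, hp, hq]

lemma map_koszulEndo (φ : S →+* T) (e : ι → ℕ) (G : ι → MvPolynomial ι S) (j : ι)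
    (ν : ι →₀ ℕ) (i : ι) :
    map φ (koszulEndo e G j ν i) = koszulEndo e (fun k => map φ (G k)) j ν i := by
  simp only [koszulEndo, Pi.add_apply, map_add, map_powerContraction, map_mul, map_monomial,
    map_one, koszulRelation, map_sub]
  simp only [Pi.single_apply, apply_ite (map φ), map_zero]

lemma powerContraction_mem_tupleDeg (e : ι → ℕ) (t : ℕ) (p : MvPolynomial ι S)
    (hp : p.IsHomogeneous t) : powerContraction S e p ∈ tupleDeg S e t := by
  rw [p.as_sum, map_sum]
  refine Submodule.sum_mem _ fun ν hν => ?_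
  have hdeg : ν.degree = t := by
    by_contra hne
    exact (mem_support_iff.1 hν) (hp.coeff_eq_zero hne)
  rw [monomial_eq_smul_one, map_smul]
  refine Submodule.smul_mem _ _ ?_
  by_cases h : ∃ i, e i ≤ ν i
  · rw [powerContraction_monomial e ν h]
    refine single_mem_tupleDeg e t _ _ fun μ hμ => ?_
    have hs := h.choose_spec
    generalize h.choose = s at hs hμ
    obtain rfl : ν - Finsupp.single s (e s) = μ := by
      by_contra hne
      simp [coeff_monomial, hne] at hμ
    have hle : Finsupp.single s (e s) ≤ ν := by simpa using hs
    rw [← hdeg]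
    conv_rhs => rw [← tsub_add_cancel_of_le hle, map_add, Finsupp.degree_single]
  · rw [powerContraction_monomial_of_not e ν h]
    exact Submodule.zero_mem _

lemma koszulRelation_mem_tupleDeg (e : ι → ℕ) (t : ℕ) (G : ι → MvPolynomial ι S)
    (hG : ∀ i, (G i).IsHomogeneous (e i)) (j : ι) (ν : ι →₀ ℕ) (hν : ν.degree + e j = t) :
    koszulRelation e G j ν ∈ tupleDeg S e t := by
  have hs := (exists_le_add_single e ν j).choose_spec
  unfold koszulRelation
  generalize (exists_le_add_single e ν j).choose = s at hs
  by_cases hsj : s = j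
  · subst hsj; simp only [sub_self, mul_zero]; exact Submodule.zero_mem _
  have hle : Finsupp.single s (e s) ≤ ν := by
    rw [Finsupp.single_le_iff]
    simpa [Finsupp.single_apply, Ne.symm hsj] using hs
  have hdeg : (ν - Finsupp.single s (e s)).degree + e s = ν.degree := by
    conv_rhs => rw [← tsub_add_cancel_of_le hle, map_add, Finsupp.degree_single]
  have hm : (monomial (ν - Finsupp.single s (e s)) (1 : S)).IsHomogeneous
      (ν - Finsupp.single s (e s)).degree := isHomogeneous_monomial _ rfl
  have key : ∀ a b : ι, (ν - Finsupp.single s (e s)).degree + e a + e b = t →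
      Pi.single b (monomial (ν - Finsupp.single s (e s)) 1 * G a) ∈ tupleDeg S e t := by
    intro a b hab
    refine single_mem_tupleDeg e t b _ fun μ hμ => ?_
    have : μ.degree = (ν - Finsupp.single s (e s)).degree + e a := by
      by_contra hne
      exact hμ ((hm.mul (hG a)).coeff_eq_zero hne)
    omega
  convert Submodule.sub_mem _ (key s j (by omega)) (key j s (by omega)) using 1
  ext1 i
  simp only [Pi.sub_apply, Pi.single_apply, mul_sub, mul_ite, mul_zero]

lemma koszulEndo_mem_tupleDeg (e : ι → ℕ) (t : ℕ) (G : ι → MvPolynomial ι S)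
    (hG : ∀ i, (G i).IsHomogeneous (e i)) (j : ι) (ν : ι →₀ ℕ) (hν : ν.degree + e j = t) :
    koszulEndo e G j ν ∈ tupleDeg S e t :=
  Submodule.add_mem _ (koszulRelation_mem_tupleDeg e t G hG j ν hν)
    (powerContraction_mem_tupleDeg e t _
      (hν ▸ (isHomogeneous_monomial (1 : S) rfl).mul (hG j)))

/-- Indices of the monomial basis of `tupleDeg S e t`. -/
abbrev TupleIdx (e : ι → ℕ) (t : ℕ) : Type _ :=
  {p : ι × (ι →₀ ℕ) // p.2.degree + e p.1 = t}

/-- The matrix of `koszulEndo` in degree `t`. -/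
noncomputable def koszulMatrix (e : ι → ℕ) (t : ℕ) (G : ι → MvPolynomial ι S) :
    Matrix (TupleIdx e t) (TupleIdx e t) S :=
  Matrix.of fun p q => coeff p.1.2 (koszulEndo e G q.1.1 q.1.2 p.1.1)

open Classical in
lemma koszulMatrix_powers (e : ι → ℕ) (t : ℕ) :
    koszulMatrix e t (fun i => monomial (Finsupp.single i (e i)) (1 : S)) = 1 := by
  ext ⟨⟨i, μ⟩, hp⟩ ⟨⟨j, ν⟩, hq⟩
  simp only [koszulMatrix, Matrix.of_apply, koszulEndo_powers, Matrix.one_apply, Subtype.mk.injEq,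
    Prod.mk.injEq]
  by_cases hij : i = j
  · subst hij; simp [coeff_monomial, eq_comm]
  · simp [hij]

variable [Fintype ι]

lemma koszulRelation_syzygy (e : ι → ℕ) (G : ι → MvPolynomial ι S) (j : ι) (ν : ι →₀ ℕ) :
    ∑ i, koszulRelation e G j ν i * G i = 0 := by
  simp only [koszulRelation, mul_assoc, ← Finset.mul_sum, sub_mul, Finset.sum_sub_distrib]
  simp [Pi.single_apply, mul_comm]

instance (e : ι → ℕ) (t : ℕ) : Finite (TupleIdx e t) := by
  refine Set.Finite.to_subtype (s := {p : ι × (ι →₀ ℕ) | p.2.degree + e p.1 = t}) ?_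
  refine (Set.finite_univ.prod (Finsupp.finite_of_degree_le t)).subset fun p hp => ?_
  exact ⟨trivial, by simp only [Set.mem_ofPred_eq] at hp ⊢; omega⟩

noncomputable instance (e : ι → ℕ) (t : ℕ) : Fintype (TupleIdx e t) := Fintype.ofFinite _

lemma koszulMatrix_map (φ : S →+* T) (e : ι → ℕ) (t : ℕ) (G : ι → MvPolynomial ι S) :
    koszulMatrix e t (fun i => map φ (G i)) = φ.mapMatrix (koszulMatrix e t G) := by
  ext p q
  simp [koszulMatrix, ← map_koszulEndo, coeff_map]

/-- The tuple with given coefficients on the monomial basis. -/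
noncomputable def tupleOfCoeffs (S : Type*) [CommRing S] (e : ι → ℕ) (t : ℕ) :
    (TupleIdx e t → S) →ₗ[S] (ι → MvPolynomial ι S) :=
  Fintype.linearCombination S fun q => Pi.single q.1.1 (monomial q.1.2 1)

lemma tupleOfCoeffs_coeff (e : ι → ℕ) (t : ℕ) (v : ι → MvPolynomial ι S)
    (hv : v ∈ tupleDeg S e t) :
    tupleOfCoeffs S e t (fun q => coeff q.1.2 (v q.1.1)) = v := by
  classical
  ext j ν
  rw [tupleOfCoeffs, Fintype.linearCombination_apply, Finset.sum_apply, coeff_sum]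
  have h : ∀ q : TupleIdx e t, coeff ν ((coeff q.1.2 (v q.1.1) •
      (Pi.single q.1.1 (monomial q.1.2 1) : ι → MvPolynomial ι S)) j) =
      if q.1 = (j, ν) then coeff ν (v j) else 0 := by
    rintro ⟨⟨i, μ⟩, hq⟩
    by_cases hij : i = j
    · subst hij
      by_cases hμ : μ = ν
      · subst hμ; simp
      · simp [coeff_monomial, hμ]
    · simp [hij, Ne.symm hij]
  simp only [h]
  by_cases hd : ν.degree + e j = t
  · rw [Finset.sum_eq_single ⟨(j, ν), hd⟩]
    · simp
    · intro q _ hq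
      rw [if_neg fun h' => hq (Subtype.ext h')]
    · simp
  · have h0 : coeff ν (v j) = 0 := by
      by_contra hne
      exact hd (hv j ν hne)
    simp [h0]

lemma tupleOfCoeffs_mulVec (e : ι → ℕ) (t : ℕ) (G : ι → MvPolynomial ι S)
    (hG : ∀ i, (G i).IsHomogeneous (e i)) (a : TupleIdx e t → S) :
    tupleOfCoeffs S e t ((koszulMatrix e t G).mulVec a) =
      ∑ q, a q • koszulEndo e G q.1.1 q.1.2 := by
  rw [← tupleOfCoeffs_coeff e t (∑ q, a q • koszulEndo e G q.1.1 q.1.2)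
    (Submodule.sum_mem _ fun q _ => Submodule.smul_mem _ _
      (koszulEndo_mem_tupleDeg e t G hG _ _ q.2))]
  congr 1
  ext p
  simp [Matrix.mulVec, dotProduct, koszulMatrix, Finset.sum_apply, coeff_sum, mul_comm]

lemma sum_koszulEndo (e : ι → ℕ) (t : ℕ) (G : ι → MvPolynomial ι S) (a : TupleIdx e t → S) :
    ∑ q, a q • koszulEndo e G q.1.1 q.1.2 =
      ∑ q, a q • koszulRelation e G q.1.1 q.1.2 +
        powerContraction S e (∑ i, tupleOfCoeffs S e t a i * G i) := by
  have : ∑ i, tupleOfCoeffs S e t a i * G i =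
      ∑ q : TupleIdx e t, a q • (monomial q.1.2 1 * G q.1.1) := by
    simp only [tupleOfCoeffs, Fintype.linearCombination_apply, Finset.sum_apply, Finset.sum_mul]
    rw [Finset.sum_comm]
    refine Finset.sum_congr rfl fun q _ => ?_
    rw [Finset.sum_eq_single q.1.1]
    · simp
    · intro i _ hi; simp [hi]
    · simp
  rw [this, map_sum, ← Finset.sum_add_distrib]
  simp only [map_smul, ← smul_add, koszulEndo]

/-- If the Koszul matrix in degree `t` is nonsingular, then each coordinate `l` of a syzygy of
degree `t` lies in the ideal generated by the other forms. -/
lemma syzygy_mem_span {K : Type*} [Field K] (e : ι → ℕ) (t : ℕ) (G : ι → MvPolynomial ι K)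
    (hG : ∀ i, (G i).IsHomogeneous (e i))
    (hM : Function.Injective (koszulMatrix e t G).mulVec)
    (v : ι → MvPolynomial ι K) (hv : v ∈ tupleDeg K e t) (hsyz : ∑ i, v i * G i = 0) (l : ι) :
    v l ∈ Ideal.span (G '' {l}ᶜ) := by
  let Z : Submodule K (TupleIdx e t → K) :=
    { carrier := {a | ∑ i, tupleOfCoeffs K e t a i * G i = 0}
      add_mem' := fun {a b} ha hb => by
        simp only [Set.mem_ofPred_eq, map_add, Pi.add_apply, add_mul, Finset.sum_add_distrib]
          at *
        rw [ha, hb, add_zero]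
      zero_mem' := by simp
      smul_mem' := fun c a ha => by
        simp only [Set.mem_ofPred_eq, map_smul, Pi.smul_apply, smul_mul_assoc, ← Finset.smul_sum]
          at *
        rw [ha, smul_zero] }
  have hZ : ∀ a ∈ Z, tupleOfCoeffs K e t ((koszulMatrix e t G).mulVec a) =
      ∑ q, a q • koszulRelation e G q.1.1 q.1.2 := by
    intro a ha
    rw [tupleOfCoeffs_mulVec e t G hG, sum_koszulEndo,
      show ∑ i, tupleOfCoeffs K e t a i * G i = 0 from ha, map_zero, add_zero]
  have hmaps : ∀ a ∈ Z, (koszulMatrix e t G).mulVecLin a ∈ Z := by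
    intro a ha
    change ∑ i, tupleOfCoeffs K e t ((koszulMatrix e t G).mulVec a) i * G i = 0
    simp only [hZ a ha, Finset.sum_apply, Pi.smul_apply, Finset.sum_mul, smul_mul_assoc]
    rw [Finset.sum_comm]
    simp [← Finset.smul_sum, koszulRelation_syzygy]
  have hsurj : Function.Surjective ((koszulMatrix e t G).mulVecLin.restrict hmaps) := by
    rw [← LinearMap.injective_iff_surjective]
    intro a b hab
    exact Subtype.ext (hM (congrArg Subtype.val hab))
  obtain ⟨⟨b, hb⟩, hbv⟩ := hsurj ⟨fun q => coeff q.1.2 (v q.1.1), by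
    change ∑ i, tupleOfCoeffs K e t _ i * G i = 0
    rw [tupleOfCoeffs_coeff e t v hv, hsyz]⟩
  have hbv' : (koszulMatrix e t G).mulVec b = fun q => coeff q.1.2 (v q.1.1) :=
    congrArg Subtype.val hbv
  rw [← tupleOfCoeffs_coeff e t v hv, ← hbv', hZ b hb, Finset.sum_apply]
  refine Ideal.sum_mem _ fun q _ => ?_
  rw [Pi.smul_apply, smul_eq_C_mul]
  exact Ideal.mul_mem_left _ _ (koszulRelation_mem_span e G _ _ l)

/-- Nonsingularity of the Koszul matrix passes from a specialisation to pure powers to any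
injective image of a family of forms. -/
lemma koszulMatrix_mulVec_injective {A F K : Type*} [CommRing A] [Field F] [Field K]
    (φ : A →+* F) (ψ : A →+* K) (hψ : Function.Injective ψ) (e : ι → ℕ) (t : ℕ)
    (G : ι → MvPolynomial ι A)
    (hφ : ∀ i, map φ (G i) = monomial (Finsupp.single i (e i)) 1) :
    Function.Injective (koszulMatrix e t fun i => map ψ (G i)).mulVec := by
  classical
  have h1 : φ (koszulMatrix e t G).det = 1 := by
    rw [RingHom.map_det, ← koszulMatrix_map, funext hφ, koszulMatrix_powers, Matrix.det_one]
  rw [Matrix.mulVec_injective_iff_isUnit, Matrix.isUnit_iff_isUnit_det, koszulMatrix_map,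
    ← RingHom.map_det, isUnit_iff_ne_zero, map_ne_zero_iff _ hψ]
  intro h0
  simp [h0] at h1

end KoszulHomotopy

section LeadingExponents

variable {n : ℕ} {K : Type*}

/-- The leading exponents of the elements of `I`. -/
def leadExps [CommRing K] (I : Ideal (MvPolynomial (Fin n) K)) : Set (Fin n →₀ ℕ) :=
  {μ | ∃ p ∈ I, IsLeadExp p μ}

lemma monomial_mem_initialIdeal_iff [Field K] (I : Ideal (MvPolynomial (Fin n) K))
    (μ : Fin n →₀ ℕ) : monomial μ (1 : K) ∈ initialIdeal I ↔ ∃ ν ∈ leadExps I, ν ≤ μ := by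
  have h : {m : MvPolynomial (Fin n) K | ∃ p ∈ I, p ≠ 0 ∧ ∃ μ, IsLeadExp p μ ∧
      m = monomial μ (1 : K)} = (fun s => monomial s (1 : K)) '' leadExps I := by
    ext m
    constructor
    · rintro ⟨p, hp, -, μ, hμ, rfl⟩
      exact ⟨μ, ⟨p, hp, hμ⟩, rfl⟩
    · rintro ⟨μ, ⟨p, hp, hμ⟩, rfl⟩
      refine ⟨p, hp, ?_, μ, hμ, rfl⟩
      rintro rfl
      simpa using hμ.1
  rw [initialIdeal, h, mem_ideal_span_monomial_image]
  classical simp [support_monomial]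

lemma isMinGen_initialIdeal_iff [Field K] (I : Ideal (MvPolynomial (Fin n) K))
    (μ : Fin n →₀ ℕ) : IsMinGen (initialIdeal I) μ ↔ Minimal (· ∈ leadExps I) μ := by
  simp only [IsMinGen, monomial_mem_initialIdeal_iff]
  constructor
  · rintro ⟨⟨ν, hν, hle⟩, hmin⟩
    obtain rfl : ν = μ := by
      by_contra hne
      exact hmin ν hle hne ⟨ν, hν, le_rfl⟩
    refine ⟨hν, fun ξ hξ hξν => ?_⟩
    by_contra hne
    exact hmin ξ hξν (fun h => hne h.ge) ⟨ξ, hξ, le_rfl⟩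
  · rintro ⟨hμ, hmin⟩
    refine ⟨⟨μ, hμ, le_rfl⟩, ?_⟩
    rintro ν hle hne ⟨ξ, hξ, hξν⟩
    exact hne (le_antisymm hle ((hmin hξ (hξν.trans hle)).trans hξν))

lemma IsLeadExp.degree_eq [CommRing K] {p : MvPolynomial (Fin n) K} {μ : Fin n →₀ ℕ}
    (h : IsLeadExp p μ) : IsLeadExp (homogeneousComponent μ.degree p) μ := by
  refine ⟨?_, fun ν hν hne => h.2 ν ?_ hne⟩
  · simpa [coeff_homogeneousComponent] using h.1
  · rw [mem_support_iff, coeff_homogeneousComponent] at hν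
    rw [mem_support_iff]
    intro h0
    simp [h0] at hν

lemma embExp_castSucc (μ : Fin n →₀ ℕ) (i : Fin n) : embExp μ i.castSucc = μ i :=
  Finsupp.embDomain_apply_self ⟨Fin.castSucc, Fin.castSucc_injective n⟩ μ i

lemma embExp_last (μ : Fin n →₀ ℕ) : embExp μ (Fin.last n) = 0 :=
  Finsupp.embDomain_of_notMem_range _ _ _ (by
    rintro ⟨i, hi⟩
    exact (Fin.castSucc_lt_last i).ne hi)

lemma exists_embExp_eq (μ : Fin (n + 1) →₀ ℕ) (h : μ (Fin.last n) = 0) :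
    ∃ ν : Fin n →₀ ℕ, embExp ν = μ := by
  refine ⟨Finsupp.equivFunOnFinite.symm fun i => μ i.castSucc, ?_⟩
  ext i
  induction i using Fin.lastCases with
  | last => rw [embExp_last, h]
  | cast i => rw [embExp_castSucc]; rfl

lemma embExp_le_iff (μ ν : Fin n →₀ ℕ) : embExp μ ≤ embExp ν ↔ μ ≤ ν := by
  constructor
  · intro h i
    simpa [embExp_castSucc] using h i.castSucc
  · intro h i
    induction i using Fin.lastCases with
    | last => simp [embExp_last]
    | cast i => simpa [embExp_castSucc] using h i

lemma embExp_injective : Function.Injective (embExp (n := n)) :=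
  Finsupp.embDomain_injective _

lemma degree_embExp (μ : Fin n →₀ ℕ) : (embExp μ).degree = μ.degree := by
  simp [Finsupp.degree_eq_sum, Fin.sum_univ_castSucc, embExp_castSucc, embExp_last]

lemma drlLT_embExp_iff (μ ν : Fin n →₀ ℕ) : DrlLT (embExp μ) (embExp ν) ↔ DrlLT μ ν := by
  have hd : ∀ ξ : Fin n →₀ ℕ, expDeg (embExp ξ) = expDeg ξ := degree_embExp
  simp only [DrlLT, hd, Fin.exists_fin_succ', Fin.forall_fin_succ', embExp_castSucc, embExp_last,
    Fin.castSucc_lt_castSucc_iff, lt_self_iff_false, false_and, or_false, implies_true, and_true]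

lemma coeff_projMap [CommRing K] (p : MvPolynomial (Fin (n + 1)) K) (ν : Fin n →₀ ℕ) :
    coeff ν (projMap K n p) = coeff (embExp ν) p := by
  induction p using MvPolynomial.induction_on' with
  | add p q hp hq => rw [map_add, coeff_add, coeff_add, hp, hq]
  | monomial μ a =>
    classical
    rw [projMap, aeval_monomial, coeff_monomial]
    by_cases h : μ (Fin.last n) = 0
    · obtain ⟨ξ, rfl⟩ := exists_embExp_eq μ h
      have : (embExp ξ).prod (fun i k => (Fin.lastCases 0 (fun j => X j) i :
          MvPolynomial (Fin n) K) ^ k) = monomial ξ 1 := by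
        rw [Finsupp.prod_fintype _ _ (by simp), Fin.prod_univ_castSucc]
        simp only [embExp_castSucc, embExp_last, Fin.lastCases_castSucc, pow_zero, mul_one]
        rw [monomial_eq, C_1, one_mul, Finsupp.prod_fintype _ _ (by simp)]
      rw [this, algebraMap_eq, coeff_C_mul, coeff_monomial]
      simp [embExp_injective.eq_iff]
    · have : μ.prod (fun i k => (Fin.lastCases 0 (fun j => X j) i :
          MvPolynomial (Fin n) K) ^ k) = 0 := by
        rw [Finsupp.prod]
        refine Finset.prod_eq_zero (Finsupp.mem_support_iff.2 h) ?_
        simp [h]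
      rw [this, mul_zero, coeff_zero, if_neg]
      rintro rfl
      exact h (embExp_last ν)

lemma projMap_surjective [CommRing K] : Function.Surjective (projMap K n) := by
  intro q
  refine ⟨rename Fin.castSucc q, ?_⟩
  rw [projMap, aeval_rename]
  convert aeval_X_left_apply q using 2
  ext1 i
  simp

lemma embExp_mem_leadExps_iff [Field K] (I : Ideal (MvPolynomial (Fin (n + 1)) K))
    (hI : ∀ p ∈ I, ∀ t, homogeneousComponent t p ∈ I) (ν : Fin n →₀ ℕ) :
    embExp ν ∈ leadExps I ↔ ν ∈ leadExps (I.map (projMap K n)) := by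
  constructor
  · rintro ⟨p, hp, hlead⟩
    refine ⟨projMap K n p, Ideal.mem_map_of_mem _ hp, ?_, fun ξ hξ hne => ?_⟩
    · rw [mem_support_iff, coeff_projMap]
      exact mem_support_iff.1 hlead.1
    · rw [mem_support_iff, coeff_projMap] at hξ
      rw [← drlLT_embExp_iff]
      exact hlead.2 _ (mem_support_iff.2 hξ) fun h => hne (embExp_injective h)
  · rintro ⟨q, hq, hlead⟩
    obtain ⟨p, hp, rfl⟩ := (Ideal.mem_map_iff_of_surjective _ projMap_surjective).1 hq
    refine ⟨homogeneousComponent ν.degree p, hI p hp _, ?_, fun ξ hξ hne => ?_⟩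
    · rw [mem_support_iff, coeff_homogeneousComponent, if_pos (degree_embExp ν), ← coeff_projMap]
      exact mem_support_iff.1 hlead.1
    · rw [mem_support_iff, coeff_homogeneousComponent, ne_eq, ite_eq_right_iff,
        Classical.not_imp] at hξ
      by_cases h : ξ (Fin.last n) = 0
      · obtain ⟨ξ, rfl⟩ := exists_embExp_eq ξ h
        rw [drlLT_embExp_iff]
        refine hlead.2 ξ ?_ fun h => hne (by rw [h])
        rw [mem_support_iff, coeff_projMap]
        exact hξ.2
      · refine Or.inr ⟨?_, Fin.last n, ?_, fun j hj => absurd hj (Fin.le_last j).not_gt⟩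
        · exact hξ.1.trans (degree_embExp ν).symm
        · rw [embExp_last]; exact Nat.pos_of_ne_zero h

/-- If the last variable is a nonzerodivisor modulo the homogeneous ideal `I`, it can be
cancelled from leading exponents. -/
lemma mem_leadExps_of_add_last [Field K] (I : Ideal (MvPolynomial (Fin (n + 1)) K))
    (hI : ∀ p ∈ I, ∀ t, homogeneousComponent t p ∈ I)
    (hreg : ∀ t p, p.IsHomogeneous t → X (Fin.last n) * p ∈ I → p ∈ I)
    (μ : Fin (n + 1) →₀ ℕ) (h : Finsupp.single (Fin.last n) 1 + μ ∈ leadExps I) :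
    μ ∈ leadExps I := by
  obtain ⟨p₀, hp₀, hlead₀⟩ := h
  have hlead := hlead₀.degree_eq
  have hp := hI p₀ hp₀ (Finsupp.single (Fin.last n) 1 + μ).degree
  have hhom := homogeneousComponent_isHomogeneous (Finsupp.single (Fin.last n) 1 + μ).degree p₀
  generalize homogeneousComponent (Finsupp.single (Fin.last n) 1 + μ).degree p₀ = p
    at hlead hp hhom
  have hdeg : ∀ ν ∈ p.support, ν.degree = (Finsupp.single (Fin.last n) 1 + μ).degree := by
    intro ν hν
    by_contra hne
    exact mem_support_iff.1 hν (hhom.coeff_eq_zero hne)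
  have hlast : ∀ ν ∈ p.support, Finsupp.single (Fin.last n) 1 ≤ ν := by
    intro ν hν
    rw [Finsupp.single_le_iff]
    by_cases hne : ν = Finsupp.single (Fin.last n) 1 + μ
    · simp [hne]
    rcases hlead.2 ν hν hne with hlt | ⟨-, i, hi, hij⟩
    · exact absurd (hdeg ν hν) hlt.ne
    · rcases (Fin.le_last i).eq_or_lt with rfl | hlt
      · exact Nat.one_le_of_lt hi
      · rw [hij _ hlt]; simp
  have hpq : X (Fin.last n) * p.divMonomial (Finsupp.single (Fin.last n) 1) = p := by
    have hmod : p.modMonomial (Finsupp.single (Fin.last n) 1) = 0 := by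
      ext ν
      by_cases hle : Finsupp.single (Fin.last n) 1 ≤ ν
      · rw [coeff_modMonomial_of_le _ hle, coeff_zero]
      · rw [coeff_modMonomial_of_not_le _ hle, coeff_zero]
        by_contra hne
        exact hle (hlast ν (mem_support_iff.2 hne))
    simpa [hmod] using p.divMonomial_add_modMonomial_single (Fin.last n)
  refine ⟨p.divMonomial (Finsupp.single (Fin.last n) 1), ?_, ?_, fun ν hν hne => ?_⟩
  · refine hreg μ.degree _ (fun ν hν => ?_) (hpq.symm ▸ hp)
    rw [coeff_divMonomial] at hν
    have := hdeg _ (mem_support_iff.2 hν)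
    rw [map_add, map_add, add_right_inj] at this
    rw [← this]
    exact (DFunLike.congr_fun Finsupp.degree_eq_weight_one ν).symm
  · rw [mem_support_iff, coeff_divMonomial]
    exact mem_support_iff.1 hlead.1
  · rw [mem_support_iff, coeff_divMonomial, ← mem_support_iff] at hν
    have hlt := hlead.2 _ hν fun h => hne (add_left_cancel h)
    have hexp : ∀ a b : Fin (n + 1) →₀ ℕ, expDeg (a + b) = expDeg a + expDeg b :=
      fun a b => map_add Finsupp.degree a b
    simpa [DrlLT, hexp] using hlt

/-- If the last variable is a nonzerodivisor modulo the homogeneous ideal `I`, then `in(I)` and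
`in(π(I))` have the same minimal generators. -/
lemma setOf_isMinGen_eq_image [Field K] (I : Ideal (MvPolynomial (Fin (n + 1)) K))
    (hI : ∀ p ∈ I, ∀ t, homogeneousComponent t p ∈ I)
    (hreg : ∀ t p, p.IsHomogeneous t → X (Fin.last n) * p ∈ I → p ∈ I) :
    {μ | IsMinGen (initialIdeal I) μ} =
      embExp '' {ν | IsMinGen (initialIdeal (I.map (projMap K n))) ν} := by
  simp only [isMinGen_initialIdeal_iff]
  have hemb := embExp_mem_leadExps_iff I hI
  ext μ
  constructor
  · rintro ⟨hμ, hmin⟩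
    have h0 : μ (Fin.last n) = 0 := by
      by_contra hne
      have hle : Finsupp.single (Fin.last n) 1 ≤ μ := by
        rw [Finsupp.single_le_iff]; exact Nat.one_le_iff_ne_zero.2 hne
      obtain ⟨ξ, rfl⟩ := exists_add_of_le hle
      have := hmin (mem_leadExps_of_add_last I hI hreg ξ hμ) le_add_self (Fin.last n)
      simp at this
    obtain ⟨ν, rfl⟩ := exists_embExp_eq μ h0
    refine ⟨ν, ⟨(hemb ν).1 hμ, fun ξ hξ hle => ?_⟩, rfl⟩
    exact (embExp_le_iff _ _).1 (hmin ((hemb ξ).2 hξ) ((embExp_le_iff _ _).2 hle))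
  · rintro ⟨ν, ⟨hν, hmin⟩, rfl⟩
    refine ⟨(hemb ν).2 hν, fun ξ hξ hle => ?_⟩
    obtain ⟨ξ, rfl⟩ := exists_embExp_eq ξ (by simpa [embExp_last] using hle (Fin.last n))
    exact (embExp_le_iff _ _).2 (hmin ((hemb ξ).1 hξ) ((embExp_le_iff _ _).1 hle))

end LeadingExponents

section GenericSequence

/-- The degrees of `f_1, …, f_n, z`. -/
def snocDeg {n : ℕ} (d : Fin n → ℕ) : Fin (n + 1) → ℕ :=
  Fin.snoc d 1

/-- The sequence `f_1, …, f_n, z`. -/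
noncomputable def snocLast {n : ℕ} {S : Type*} [CommRing S]
    (f : Fin n → MvPolynomial (Fin (n + 1)) S) : Fin (n + 1) → MvPolynomial (Fin (n + 1)) S :=
  Fin.snoc f (X (Fin.last n))

lemma snocLast_isHomogeneous {n : ℕ} {S : Type*} [CommRing S] (d : Fin n → ℕ)
    (f : Fin n → MvPolynomial (Fin (n + 1)) S) (hf : ∀ i, (f i).IsHomogeneous (d i))
    (i : Fin (n + 1)) : (snocLast f i).IsHomogeneous (snocDeg d i) := by
  induction i using Fin.lastCases with
  | last => simpa [snocLast, snocDeg] using isHomogeneous_X S (Fin.last n)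
  | cast i => simpa [snocLast, snocDeg] using hf i

lemma finite_expDeg_eq (m t : ℕ) : Finite {μ : Fin m →₀ ℕ // expDeg μ = t} :=
  (Finsupp.finite_of_degree_eq t).to_subtype

/-- The forms of degrees `d i` whose coefficients are independent indeterminates. -/
noncomputable def universalForm (F : Type*) [CommRing F] {n r : ℕ} (d : Fin r → ℕ) (i : Fin r) :
    MvPolynomial (Fin n)
      (MvPolynomial (Σ i : Fin r, {μ : Fin n →₀ ℕ // expDeg μ = d i}) F) :=
  letI := finite_expDeg_eq n (d i)
  letI := Fintype.ofFinite {μ : Fin n →₀ ℕ // expDeg μ = d i}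
  ∑ μ : {μ : Fin n →₀ ℕ // expDeg μ = d i}, monomial μ.1 (X ⟨i, μ⟩)

lemma map_universalForm {F S : Type*} [CommRing F] [CommRing S] {n r : ℕ} (d : Fin r → ℕ)
    (φ : MvPolynomial (Σ i : Fin r, {μ : Fin n →₀ ℕ // expDeg μ = d i}) F →+* S)
    (i : Fin r) (g : MvPolynomial (Fin n) S) (hg : g.IsHomogeneous (d i))
    (h : ∀ μ : {μ : Fin n →₀ ℕ // expDeg μ = d i}, φ (X ⟨i, μ⟩) = coeff μ.1 g) :
    map φ (universalForm F d i) = g := by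
  classical
  ext ν
  simp only [universalForm, map_sum, map_monomial, h, coeff_sum, coeff_monomial]
  by_cases hν : expDeg ν = d i
  · rw [Finset.sum_eq_single ⟨ν, hν⟩]
    · simp
    · intro μ _ hne
      rw [if_neg fun h' => hne (Subtype.ext h')]
    · simp
  · rw [hg.coeff_eq_zero hν]
    refine Finset.sum_eq_zero fun μ _ => if_neg ?_
    rintro rfl
    exact hν μ.2

lemma homogeneousComponent_mul_of_isHomogeneous {σ S : Type*} [CommRing S] (p : MvPolynomial σ S)
    {q : MvPolynomial σ S} {e : ℕ} (hq : q.IsHomogeneous e) (t : ℕ) :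
    homogeneousComponent t (p * q) =
      if e ≤ t then homogeneousComponent (t - e) p * q else 0 := by
  let _ : GradedRing (homogeneousSubmodule σ S) := gradedAlgebra
  have key : ∀ (r : MvPolynomial σ S) (i : ℕ),
      (DirectSum.decompose (homogeneousSubmodule σ S) r i : MvPolynomial σ S) =
        homogeneousComponent i r := fun r i => decomposition.decompose'_apply r i
  have hq' : q ∈ homogeneousSubmodule σ S e := hq
  rw [← key, ← key]
  split_ifs with h
  · exact DirectSum.coe_decompose_mul_of_right_mem_of_le _ hq' h
  · exact DirectSum.coe_decompose_mul_of_right_mem_of_not_le _ hq' h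

lemma exists_homogeneous_combination {n : ℕ} {S : Type*} [CommRing S] (d : Fin n → ℕ)
    (f : Fin n → MvPolynomial (Fin (n + 1)) S) (hf : ∀ i, (f i).IsHomogeneous (d i)) (t : ℕ)
    (p : MvPolynomial (Fin (n + 1)) S) (hp : p.IsHomogeneous t)
    (hmem : p ∈ Ideal.span (Set.range f)) :
    ∃ g : Fin n → MvPolynomial (Fin (n + 1)) S,
      (∀ i ν, coeff ν (g i) ≠ 0 → ν.degree + d i = t) ∧ ∑ i, g i * f i = p := by
  obtain ⟨c, rfl⟩ := Ideal.mem_span_range_iff_exists_fun.1 hmem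
  refine ⟨fun i => if d i ≤ t then homogeneousComponent (t - d i) (c i) else 0, ?_, ?_⟩
  · intro i ν hν
    by_cases h : d i ≤ t
    · simp only [if_pos h, coeff_homogeneousComponent, ne_eq, ite_eq_right_iff,
        Classical.not_imp] at hν
      omega
    · simp [h] at hν
  · conv_rhs => rw [← homogeneousComponent_eq_self hp, map_sum]
    refine Finset.sum_congr rfl fun i _ => ?_
    rw [homogeneousComponent_mul_of_isHomogeneous _ (hf i), ite_mul, zero_mul]

/-- The last variable is a nonzerodivisor modulo a generic ideal `(f_1, …, f_n)`. -/
lemma IsGenericSeq.mem_span_of_X_last_mul_mem {F K : Type*} [Field F] [Field K] [Algebra F K]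
    {n : ℕ} (d : Fin n → ℕ) (f : Fin n → MvPolynomial (Fin (n + 1)) K) (hf : IsGenericSeq F d f)
    (t : ℕ) (p : MvPolynomial (Fin (n + 1)) K) (hp : p.IsHomogeneous t)
    (h : X (Fin.last n) * p ∈ Ideal.span (Set.range f)) : p ∈ Ideal.span (Set.range f) := by
  classical
  obtain ⟨g, hgdeg, hgsum⟩ := exists_homogeneous_combination d f hf.1 (1 + t) _
    ((isHomogeneous_X K (Fin.last n)).mul hp) h
  let ψ := (aeval (R := F) fun q : Σ i : Fin n, {μ : Fin (n + 1) →₀ ℕ // expDeg μ = d i} =>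
    (f q.1).coeff q.2.1)
  let φ := (aeval (R := F) fun q : Σ i : Fin n, {μ : Fin (n + 1) →₀ ℕ // expDeg μ = d i} =>
    coeff q.2.1 (monomial (Finsupp.single q.1.castSucc (d q.1)) (1 : F)))
  have hM := koszulMatrix_mulVec_injective φ.toRingHom ψ.toRingHom hf.2 (snocDeg d) (1 + t)
    (snocLast (universalForm F d)) (by
      intro i
      induction i using Fin.lastCases with
      | last => simp [snocLast, snocDeg, X]
      | cast i =>
        simp only [snocLast, snocDeg, Fin.snoc_castSucc]
        refine map_universalForm d _ i _ (isHomogeneous_monomial _ (by simp)) fun μ => ?_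
        simp [φ])
  have hψ : (fun i => map ψ.toRingHom (snocLast (universalForm F d) i)) = snocLast f := by
    ext1 i
    induction i using Fin.lastCases with
    | last => simp [snocLast]
    | cast i =>
      simp only [snocLast, Fin.snoc_castSucc]
      exact map_universalForm d _ i _ (hf.1 i) fun μ => by simp [ψ]
  rw [hψ] at hM
  have key := syzygy_mem_span (snocDeg d) (1 + t) (snocLast f)
    (snocLast_isHomogeneous d f hf.1) hM (Fin.snoc (fun i => -g i) p)
    (by
      intro j ν hν
      induction j using Fin.lastCases with
      | last =>
        rw [Fin.snoc_last] at hν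
        have : ν.degree = t := by
          by_contra hne
          exact hν (hp.coeff_eq_zero hne)
        simp only [snocDeg, Fin.snoc_last]
        omega
      | cast i =>
        rw [Fin.snoc_castSucc, coeff_neg, neg_ne_zero] at hν
        simpa [snocDeg] using hgdeg i ν hν)
    (by
      rw [Fin.sum_univ_castSucc]
      simp only [snocLast, Fin.snoc_castSucc, Fin.snoc_last, neg_mul, Finset.sum_neg_distrib, hgsum]
      ring)
    (Fin.last n)
  rw [Fin.snoc_last] at key
  refine Ideal.span_mono ?_ key
  rintro _ ⟨i, hi, rfl⟩
  induction i using Fin.lastCases with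
  | last => exact absurd rfl hi
  | cast i => exact ⟨i, by simp [snocLast]⟩

lemma homogeneousComponent_mem_span {σ ι S : Type*} [CommRing S] (d : ι → ℕ)
    (f : ι → MvPolynomial σ S) (hf : ∀ i, (f i).IsHomogeneous (d i)) (p : MvPolynomial σ S)
    (hp : p ∈ Ideal.span (Set.range f)) (t : ℕ) :
    homogeneousComponent t p ∈ Ideal.span (Set.range f) := by
  let _ : GradedRing (homogeneousSubmodule σ S) := gradedAlgebra
  have h := Ideal.homogeneous_span (homogeneousSubmodule σ S) (Set.range f) (by
    rintro _ ⟨i, rfl⟩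
    exact ⟨d i, hf i⟩)
  exact homogeneousComponent_mem_of_mem h hp t

end GenericSequence

/-- the initial ideals of a generic ideal `I ⊆ K[x_1,…,x_n,z]` of type
`(n+1; d_1,…,d_n)` and of its image `J = π(I) ⊆ K[x_1,…,x_n]` under `z ↦ 0` have the same
minimal monomial generators. -/
theorem stmt0 {F K : Type*} [Field F] [Field K] [Algebra F K] [Infinite K]
    {n : ℕ} (d : Fin n → ℕ) (hd : ∀ i, 1 ≤ d i)
    (f : Fin n → MvPolynomial (Fin (n + 1)) K)
    (hf : IsGenericSeq F d f)
    (I : Ideal (MvPolynomial (Fin (n + 1)) K)) (hI : I = Ideal.span (Set.range f))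
    (J : Ideal (MvPolynomial (Fin n) K)) (hJ : J = I.map (projMap K n)) :
    { μ | IsMinGen (initialIdeal I) μ } = embExp '' { ν | IsMinGen (initialIdeal J) ν } := by
  subst hI hJ
  exact setOf_isMinGen_eq_image _ (homogeneousComponent_mem_span d f hf.1)
    (hf.mem_span_of_X_last_mul_mem d f)
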